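/- arXiv:2411.03352 — 2 statements merged into one kernel-verified Lean document; each statement's English description precedes it below -/
import Mathlib

section
/- If f is analytic in 𝔻 with |f(z)| ≤ 1, then for every n ≥ 1 and z ∈ 𝔻, |f^{(n)}(z)|/n! ≤ (1 - |f(z)|^2)/((1 - |z|)^{n-1}(1 - |z|^2)). -/
open Metric Filter Topology

lemma aux_lin_iter (b : ℂ) (w : ℂ) (i : ℕ) :
    iteratedDeriv (i + 2) (fun w : ℂ => 1 + b * w) w = 0 := by
  have h : deriv (fun w : ℂ => 1 + b * w) = fun _ => b := by
    funext x
    have := ((hasDerivAt_id x).const_mul b).const_add 1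
    simpa using this.deriv
  rw [iteratedDeriv_succ', h, iteratedDeriv_const]
  simp

lemma aux_lin_mul (b w : ℂ) (H : ℂ → ℂ) (k : ℕ) (hH : AnalyticAt ℂ H w) :
    iteratedDeriv (k + 1) (fun w => (1 + b * w) * H w) w =
      (1 + b * w) * iteratedDeriv (k + 1) H w + (k + 1) * b * iteratedDeriv k H w := by
  have h1 : deriv (fun w : ℂ => 1 + b * w) w = b := by
    have := ((hasDerivAt_id w).const_mul b).const_add 1
    simpa using this.deriv
  have hu : ContDiffAt ℂ (k + 1 : ℕ) (fun w : ℂ => 1 + b * w) w := by fun_prop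
  rw [iteratedDeriv_fun_mul hu hH.contDiffAt, Finset.sum_range_succ', Finset.sum_range_succ',
    Finset.sum_eq_zero]
  · simp [iteratedDeriv_one, h1]
    ring
  · intro i _
    rw [aux_lin_iter]; simp

lemma aux_pow_iter (b : ℂ) (m i : ℕ) :
    iteratedDeriv i (fun w : ℂ => (1 + b * w) ^ m) =
      fun w => (m.descFactorial i : ℂ) * b ^ i * (1 + b * w) ^ (m - i) := by
  induction i with
  | zero => simp
  | succ i ih =>
    rw [iteratedDeriv_succ, ih]
    funext w
    have h0 := ((hasDerivAt_id w).const_mul b).const_add 1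
    have := ((h0.pow (m - i)).const_mul ((m.descFactorial i : ℂ) * b ^ i)).deriv
    simp only [id, mul_one, Pi.pow_apply] at this
    refine Eq.trans this ?_
    rw [Nat.descFactorial_succ, Nat.sub_sub]
    push_cast
    ring

lemma aux_denom {a w : ℂ} (ha : ‖a‖ < 1) (hw : ‖w‖ < 1) :
    1 + (starRingEnd ℂ) a * w ≠ 0 := by
  intro h
  have h1 : (starRingEnd ℂ) a * w = -1 := by linear_combination h
  have h2 : ‖a‖ * ‖w‖ = 1 := by
    have := congrArg norm h1
    simpa using this
  nlinarith [norm_nonneg a, norm_nonneg w]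

lemma aux_normsq (a w : ℂ) :
    ‖1 + (starRingEnd ℂ) a * w‖ ^ 2 - ‖w + a‖ ^ 2 = (1 - ‖a‖ ^ 2) * (1 - ‖w‖ ^ 2) := by
  simp only [← Complex.normSq_eq_norm_sq, Complex.normSq_apply]
  simp
  ring

lemma aux_mobius {a w : ℂ} (ha : ‖a‖ < 1) (hw : ‖w‖ < 1) :
    ‖(w + a) / (1 + (starRingEnd ℂ) a * w)‖ < 1 := by
  have h := aux_normsq a w
  have hd := norm_pos_iff.mpr (aux_denom ha hw)
  rw [norm_div, div_lt_one hd]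
  have : 0 < (1 - ‖a‖ ^ 2) * (1 - ‖w‖ ^ 2) := by
    apply mul_pos <;> nlinarith [norm_nonneg a, norm_nonneg w]
  exact lt_of_pow_lt_pow_left₀ 2 hd.le (by linarith)

lemma aux_mobius_deriv {a w : ℂ} (ha : ‖a‖ < 1) (hw : ‖w‖ < 1) :
    HasDerivAt (fun w => (w + a) / (1 + (starRingEnd ℂ) a * w))
      ((1 - (starRingEnd ℂ) a * a) / (1 + (starRingEnd ℂ) a * w) ^ 2) w := by
  have h0 := ((hasDerivAt_id w).const_mul ((starRingEnd ℂ) a)).const_add 1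
  have h1 := (hasDerivAt_id w).add_const a
  have := h1.div h0 (aux_denom ha hw)
  refine this.congr_deriv ?_
  simp only [id]
  ring

lemma aux_an {f : ℂ → ℂ} (hf : DifferentiableOn ℂ f (ball (0 : ℂ) 1)) {w : ℂ} (hw : ‖w‖ < 1) :
    AnalyticAt ℂ f w :=
  hf.analyticAt (isOpen_ball.mem_nhds (by simpa using hw))

/-- Bol's lemma. -/
lemma aux_bol {f : ℂ → ℂ} (hf : DifferentiableOn ℂ f (ball (0 : ℂ) 1)) {a : ℂ} (ha : ‖a‖ < 1)
    (m : ℕ) : ∀ w : ℂ, ‖w‖ < 1 →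
    iteratedDeriv (m + 1) (fun w => (1 + (starRingEnd ℂ) a * w) ^ m *
        f ((w + a) / (1 + (starRingEnd ℂ) a * w))) w =
      (1 - (starRingEnd ℂ) a * a) ^ (m + 1) / (1 + (starRingEnd ℂ) a * w) ^ (m + 2) *
        iteratedDeriv (m + 1) f ((w + a) / (1 + (starRingEnd ℂ) a * w)) := by
  induction m with
  | zero =>
    intro w hw
    have h1 := (aux_an hf (aux_mobius ha hw)).differentiableAt.hasDerivAt
    have := (h1.comp w (aux_mobius_deriv ha hw)).deriv
    simp only [zero_add, iteratedDeriv_one, pow_zero, one_mul, pow_one]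
    refine Eq.trans this ?_
    ring
  | succ m ih =>
    intro w hw
    have hd := aux_denom ha hw
    set b := (starRingEnd ℂ) a with hb
    set H : ℂ → ℂ := fun w => (1 + b * w) ^ m * f ((w + a) / (1 + b * w)) with hH
    have hHan : AnalyticAt ℂ H w := by
      have h1 : AnalyticAt ℂ (fun w => (w + a) / (1 + b * w)) w := by
        have n1 : AnalyticAt ℂ (fun w => w + a) w := by fun_prop
        have n2 : AnalyticAt ℂ (fun w => 1 + b * w) w := by fun_prop
        exact n1.div n2 hd
      have h2 : AnalyticAt ℂ (fun w => f ((w + a) / (1 + b * w))) w :=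
        AnalyticAt.fun_comp (aux_an hf (aux_mobius ha hw)) h1
      have h3 : AnalyticAt ℂ (fun w => (1 + b * w) ^ m) w := by fun_prop
      exact h3.mul h2
    have e : (fun w => (1 + b * w) ^ (m + 1) * f ((w + a) / (1 + b * w))) =
        fun w => (1 + b * w) * H w := by
      funext x; simp only [hH]; ring
    rw [e, aux_lin_mul b w H (m + 1) hHan, ih w hw, iteratedDeriv_succ]
    have hev : iteratedDeriv (m + 1) H =ᶠ[𝓝 w] fun w =>
        (1 - b * a) ^ (m + 1) / (1 + b * w) ^ (m + 2) *
        iteratedDeriv (m + 1) f ((w + a) / (1 + b * w)) := by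
      have : ball (0 : ℂ) 1 ∈ 𝓝 w := isOpen_ball.mem_nhds (by simpa using hw)
      filter_upwards [this] with x hx
      exact ih x (by simpa using hx)
    rw [hev.deriv_eq]
    have hF : HasDerivAt (iteratedDeriv (m + 1) f) (iteratedDeriv (m + 2) f ((w + a) / (1 + b * w)))
        ((w + a) / (1 + b * w)) := by
      rw [iteratedDeriv_succ (n := m + 1)]
      refine DifferentiableAt.hasDerivAt ?_
      have := (aux_an hf (aux_mobius ha hw)).iterated_deriv (m + 1)
      rw [← iteratedDeriv_eq_iterate] at this
      exact this.differentiableAt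
    have h1 := hF.comp w (aux_mobius_deriv ha hw)
    have h0 := ((hasDerivAt_id w).const_mul b).const_add 1
    have h2 := (hasDerivAt_const w ((1 - b * a) ^ (m + 1))).div (h0.pow (m + 2)) (pow_ne_zero _ hd)
    have h3 := (h2.mul h1).deriv
    rw [show deriv (fun w => (1 - b * a) ^ (m + 1) / (1 + b * w) ^ (m + 2) *
        iteratedDeriv (m + 1) f ((w + a) / (1 + b * w))) w = _ from h3]
    simp only [id, Pi.pow_apply, Pi.div_apply, Function.comp, mul_one, zero_mul, zero_sub]
    have e1 : m + 2 - 1 = m + 1 := rfl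
    rw [e1]
    push_cast
    rw [← hb]
    generalize iteratedDeriv (m + 1 + 1) f _ = X
    generalize iteratedDeriv (m + 1) f _ = Z
    generalize 1 + b * w = u at *
    field_simp
    ring

lemma aux_rot {g : ℂ → ℂ} (hg : DifferentiableOn ℂ g (ball (0 : ℂ) 1)) {c : ℂ} (hc : ‖c‖ = 1)
    (n : ℕ) : iteratedDeriv n (fun w => g (c * w)) 0 = c ^ n * iteratedDeriv n g 0 := by
  have h0 : (0 : ℂ) ∈ ball (0 : ℂ) 1 := by simp
  have := iteratedDerivWithin_comp_const_smul (n := n) h0 isOpen_ball.uniqueDiffOn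
    (hg.contDiffOn isOpen_ball) c (fun x hx => by simpa [hc] using hx)
  rw [iteratedDerivWithin_of_isOpen isOpen_ball h0,
    iteratedDerivWithin_of_isOpen isOpen_ball (by simp)] at this
  simpa using this

lemma aux_cauchy {q : ℂ → ℂ} (hq : DifferentiableOn ℂ q (ball (0 : ℂ) 1))
    (hb : ∀ w ∈ ball (0 : ℂ) 1, ‖q w‖ ≤ 1) (n : ℕ) :
    ‖iteratedDeriv n q 0‖ ≤ n.factorial := by
  have key : ∀ R ∈ Set.Ioo (0 : ℝ) 1, ‖iteratedDeriv n q 0‖ * R ^ n ≤ n.factorial := by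
    intro R hR
    have hsub : closedBall (0 : ℂ) R ⊆ ball 0 1 := closedBall_subset_ball hR.2
    have := Complex.norm_iteratedDeriv_le_of_forall_mem_sphere_norm_le (c := 0) (R := R) (C := 1)
      (f := q) n hR.1 (DifferentiableOn.diffContOnCl_ball hq hsub)
      (fun z hz => hb z (hsub (sphere_subset_closedBall hz)))
    rw [le_div_iff₀ (pow_pos hR.1 n)] at this
    simpa using this
  have hlim : Tendsto (fun R : ℝ => ‖iteratedDeriv n q 0‖ * R ^ n) (𝓝[<] 1)
      (𝓝 (‖iteratedDeriv n q 0‖ * 1 ^ n)) := by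
    apply Tendsto.mono_left _ nhdsWithin_le_nhds
    exact (Continuous.tendsto (by fun_prop) 1)
  rw [one_pow, mul_one] at hlim
  refine le_of_tendsto hlim ?_
  filter_upwards [Ioo_mem_nhdsLT (zero_lt_one : (0 : ℝ) < 1)] with R hR using key R hR

lemma aux_gap {h : ℂ → ℂ} (hh : DifferentiableOn ℂ h (ball (0 : ℂ) 1))
    (hb : ∀ w ∈ ball (0 : ℂ) 1, ‖h w‖ < 1) (n : ℕ) (hn : 1 ≤ n)
    (hgap : ∀ k, 0 < k → k < n → iteratedDeriv k h 0 = 0) :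
    ‖iteratedDeriv n h 0‖ ≤ (1 - ‖h 0‖ ^ 2) * n.factorial := by
  have h0 : ‖h 0‖ < 1 := hb 0 (by simp)
  have h0' : ‖-h 0‖ < 1 := by simpa using h0
  set c := h 0 with hc
  set d : ℂ := (starRingEnd ℂ) (-c) with hd
  set q : ℂ → ℂ := fun w => (h w + -c) / (1 + d * h w) with hq
  have hden : ∀ w ∈ ball (0 : ℂ) 1, 1 + d * h w ≠ 0 := fun w hw => aux_denom h0' (hb w hw)
  have hqd : DifferentiableOn ℂ q (ball (0 : ℂ) 1) :=
    (hh.add_const _).div ((hh.const_mul d).const_add 1) hden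
  have hqn := aux_cauchy hqd (fun w hw => (aux_mobius h0' (hb w hw)).le) n
  have z1 : ‖(0 : ℂ)‖ < 1 := by simp
  have han := aux_an hh z1
  have haq := aux_an hqd z1
  have hlin : ∀ k, 0 < k → iteratedDeriv k (fun w => 1 + d * h w) 0 = d * iteratedDeriv k h 0 := by
    intro k hk
    rw [iteratedDeriv_const_add hk, iteratedDeriv_const_mul_field]
  have hprod : iteratedDeriv n (fun w => q w * (1 + d * h w)) 0 = iteratedDeriv n h 0 := by
    have : (fun w => q w * (1 + d * h w)) =ᶠ[𝓝 0] fun w => -c + h w := by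
      filter_upwards [isOpen_ball.mem_nhds (show (0 : ℂ) ∈ ball (0 : ℂ) 1 by simp)] with w hw
      simp only [hq]
      rw [div_mul_cancel₀ _ (hden w hw)]; ring
    rw [this.iteratedDeriv_eq, iteratedDeriv_const_add hn]
  have hda : AnalyticAt ℂ (fun w => 1 + d * h w) 0 := by fun_prop
  rw [iteratedDeriv_fun_mul haq.contDiffAt hda.contDiffAt, Finset.sum_range_succ,
    Finset.sum_eq_zero] at hprod
  · rw [← hprod]
    have e : 1 + d * h 0 = ((1 - ‖c‖ ^ 2 : ℝ) : ℂ) := by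
      have := Complex.conj_mul' c
      rw [hd, ← hc]; push_cast; rw [← this]; simp; ring
    have hp : 0 ≤ 1 - ‖c‖ ^ 2 := by nlinarith [norm_nonneg c]
    simp only [Nat.choose_self, Nat.cast_one, one_mul, Nat.sub_self, iteratedDeriv_zero, zero_add]
    rw [e, norm_mul, Complex.norm_real, Real.norm_of_nonneg hp, mul_comm]
    gcongr
  · intro i hi
    rw [Finset.mem_range] at hi
    rcases Nat.eq_zero_or_pos i with rfl | hi0
    · simp [hq, ← hc]
    · rw [hlin (n - i) (by omega), hgap (n - i) (by omega) (by omega)]; simp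

lemma aux_coeff_strict {g : ℂ → ℂ} (hg : DifferentiableOn ℂ g (ball (0 : ℂ) 1))
    (hb : ∀ w ∈ ball (0 : ℂ) 1, ‖g w‖ < 1) (n : ℕ) (hn : 1 ≤ n) :
    ‖iteratedDeriv n g 0‖ ≤ (1 - ‖g 0‖ ^ 2) * n.factorial := by
  have hn0 : n ≠ 0 := by omega
  have hnC : (n : ℂ) ≠ 0 := by exact_mod_cast hn0
  obtain ⟨ζ, hζ⟩ : ∃ ζ : ℂ, IsPrimitiveRoot ζ n := ⟨_, Complex.isPrimitiveRoot_exp n hn0⟩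
  have hζ1 : ‖ζ‖ = 1 := hζ.norm'_eq_one hn0
  have hζj : ∀ j : ℕ, ‖ζ ^ j‖ = 1 := fun j => by simp [hζ1]
  have hmaps : ∀ j : ℕ, ∀ w ∈ ball (0 : ℂ) 1, ζ ^ j * w ∈ ball (0 : ℂ) 1 := by
    intro j w hw; simpa [hζ1] using hw
  have hgj : ∀ j : ℕ, DifferentiableOn ℂ (fun w => g (ζ ^ j * w)) (ball (0 : ℂ) 1) := fun j =>
    hg.comp (by fun_prop) (hmaps j)
  set h : ℂ → ℂ := fun w => (n : ℂ)⁻¹ * ∑ j ∈ Finset.range n, g (ζ ^ j * w) with hh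
  have hder : ∀ k, iteratedDeriv k h 0 =
      (n : ℂ)⁻¹ * (∑ j ∈ Finset.range n, (ζ ^ k) ^ j) * iteratedDeriv k g 0 := by
    intro k
    rw [hh, iteratedDeriv_const_mul_field, iteratedDeriv_fun_sum, mul_assoc, Finset.sum_mul]
    · congr 1
      refine Finset.sum_congr rfl fun j _ => ?_
      rw [aux_rot hg (hζj j), ← pow_mul, ← pow_mul, mul_comm j k]
    · intro j _
      exact (aux_an (hgj j) (by simp)).contDiffAt
  have hhd : DifferentiableOn ℂ h (ball (0 : ℂ) 1) :=
    (DifferentiableOn.fun_sum fun j _ => hgj j).const_mul _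
  have hhb : ∀ w ∈ ball (0 : ℂ) 1, ‖h w‖ < 1 := by
    intro w hw
    have hnR : (0 : ℝ) < n := by exact_mod_cast hn
    have : ‖∑ j ∈ Finset.range n, g (ζ ^ j * w)‖ < n := by
      refine (norm_sum_le _ _).trans_lt ?_
      calc _ < ∑ j ∈ Finset.range n, (1 : ℝ) :=
            Finset.sum_lt_sum_of_nonempty (by simpa using hn0) fun j _ => hb _ (hmaps j w hw)
        _ = n := by simp
    simp only [hh, norm_mul, norm_inv, Complex.norm_natCast]
    rw [inv_mul_lt_iff₀ hnR]; simpa using this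
  have hh0 : h 0 = g 0 := by simp [hh, hnC]
  have key := aux_gap hhd hhb n hn ?_
  · rw [hder n, hζ.pow_eq_one, hh0] at key
    simpa [hnC] using key
  · intro k hk hkn
    have hne : ζ ^ k ≠ 1 := hζ.pow_ne_one_of_pos_of_lt hk.ne' hkn
    have : ∑ j ∈ Finset.range n, (ζ ^ k) ^ j = 0 := by
      rw [geom_sum_eq hne, ← pow_mul, mul_comm, pow_mul, hζ.pow_eq_one]; simp
    rw [hder, this]; simp

lemma aux_coeff {g : ℂ → ℂ} (hg : DifferentiableOn ℂ g (ball (0 : ℂ) 1))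
    (hb : ∀ w ∈ ball (0 : ℂ) 1, ‖g w‖ ≤ 1) (n : ℕ) (hn : 1 ≤ n) :
    ‖iteratedDeriv n g 0‖ ≤ (1 - ‖g 0‖ ^ 2) * n.factorial := by
  have key : ∀ t ∈ Set.Ioo (0 : ℝ) 1,
      t * ‖iteratedDeriv n g 0‖ ≤ (1 - (t * ‖g 0‖) ^ 2) * n.factorial := by
    intro t ht
    have := aux_coeff_strict (g := fun w => (t : ℂ) * g w) (hg.const_mul _) (fun w hw => by
      rw [norm_mul, Complex.norm_real, Real.norm_of_nonneg ht.1.le]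
      nlinarith [hb w hw, ht.1, ht.2]) n hn
    rw [iteratedDeriv_const_mul_field, norm_mul, norm_mul, Complex.norm_real,
      Real.norm_of_nonneg ht.1.le] at this
    exact this
  have hl : Tendsto (fun t : ℝ => t * ‖iteratedDeriv n g 0‖) (𝓝[<] 1)
      (𝓝 (1 * ‖iteratedDeriv n g 0‖)) :=
    Tendsto.mono_left (Continuous.tendsto (by fun_prop) 1) nhdsWithin_le_nhds
  have hr : Tendsto (fun t : ℝ => (1 - (t * ‖g 0‖) ^ 2) * (n.factorial : ℝ)) (𝓝[<] 1)
      (𝓝 ((1 - (1 * ‖g 0‖) ^ 2) * n.factorial)) :=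
    Tendsto.mono_left (Continuous.tendsto (by fun_prop) 1) nhdsWithin_le_nhds
  have := le_of_tendsto_of_tendsto hl hr (by
    filter_upwards [Ioo_mem_nhdsLT (zero_lt_one : (0 : ℝ) < 1)] with t ht using key t ht)
  simpa using this

lemma aux_final {g : ℂ → ℂ} (hg : DifferentiableOn ℂ g (ball (0 : ℂ) 1))
    (hb : ∀ w ∈ ball (0 : ℂ) 1, ‖g w‖ ≤ 1) (b : ℂ) (m : ℕ) :
    ‖iteratedDeriv (m + 1) (fun w => (1 + b * w) ^ m * g w) 0‖ ≤
      (1 - ‖g 0‖ ^ 2) * (m + 1).factorial * (1 + ‖b‖) ^ m := by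
  have hu : ContDiffAt ℂ (m + 1 : ℕ) (fun w : ℂ => (1 + b * w) ^ m) 0 := by fun_prop
  rw [iteratedDeriv_fun_mul hu (aux_an hg (by simp)).contDiffAt, Finset.sum_range_succ]
  simp only [aux_pow_iter]
  rw [Nat.descFactorial_of_lt (Nat.lt_succ_self m)]
  simp only [Nat.cast_zero, zero_mul, mul_zero, add_zero, one_pow, mul_one]
  refine (norm_sum_le _ _).trans ?_
  rw [add_comm (1 : ℝ), add_pow, Finset.mul_sum]
  refine Finset.sum_le_sum fun i hi => ?_
  have hi' : i ≤ m := by simpa [Nat.lt_succ_iff] using hi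
  have hc := aux_coeff hg hb (m + 1 - i) (by omega)
  simp only [norm_mul, norm_pow, Complex.norm_natCast, one_pow, mul_one]
  have e : ((m + 1).choose i : ℝ) * (m.descFactorial i) * (m + 1 - i).factorial =
      (m + 1).factorial * m.choose i := by
    have h1 := Nat.choose_mul_factorial_mul_factorial (show i ≤ m + 1 by omega)
    have h2 := Nat.descFactorial_eq_factorial_mul_choose m i
    rw [h2, ← h1]; push_cast; ring
  calc _ ≤ ((m + 1).choose i : ℝ) * ((m.descFactorial i) * ‖b‖ ^ i) *
        ((1 - ‖g 0‖ ^ 2) * (m + 1 - i).factorial) := by gcongr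
    _ = (1 - ‖g 0‖ ^ 2) * ‖b‖ ^ i *
        (((m + 1).choose i : ℝ) * (m.descFactorial i) * (m + 1 - i).factorial) := by ring
    _ = _ := by rw [e]; ring


/-- Derivative bound for bounded analytic functions on the unit disk:
`|f⁽ⁿ⁾(z)|/n! ≤ (1 - |f(z)|²) / ((1 - |z|)^(n-1) (1 - |z|²))` for `n ≥ 1`. -/
theorem deriv_bound (f : ℂ → ℂ)
    (hf : DifferentiableOn ℂ f (Metric.ball (0 : ℂ) 1))
    (hb : ∀ z ∈ Metric.ball (0 : ℂ) 1, ‖f z‖ ≤ 1) :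
    ∀ n : ℕ, 1 ≤ n → ∀ z ∈ Metric.ball (0 : ℂ) 1,
      ‖iteratedDeriv n f z‖ / (n.factorial : ℝ) ≤
        (1 - ‖f z‖ ^ 2) / ((1 - ‖z‖) ^ (n - 1) * (1 - ‖z‖ ^ 2)) := by
  intro n hn z hz
  obtain ⟨m, rfl⟩ : ∃ m, n = m + 1 := ⟨n - 1, by omega⟩
  have ha : ‖z‖ < 1 := by simpa using hz
  have hbol := aux_bol hf ha m 0 (by simp)
  have hgd : DifferentiableOn ℂ (fun w => f ((w + z) / (1 + (starRingEnd ℂ) z * w)))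
      (ball (0 : ℂ) 1) := by
    refine hf.comp (g := f) (fun w hw => ?_) (fun w hw => ?_)
    · exact (aux_mobius_deriv ha (by simpa using hw)).differentiableAt.differentiableWithinAt
    · simpa using aux_mobius ha (w := w) (by simpa using hw)
  have hfin := aux_final hgd (fun w hw => hb _ (by
    simpa using aux_mobius ha (w := w) (by simpa using hw))) ((starRingEnd ℂ) z) m
  rw [hbol] at hfin
  have e : 1 - (starRingEnd ℂ) z * z = ((1 - ‖z‖ ^ 2 : ℝ) : ℂ) := by
    have := Complex.conj_mul' z
    push_cast; rw [← this]
  have hp : 0 < 1 - ‖z‖ ^ 2 := by nlinarith [norm_nonneg z]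
  have hp1 : 0 < 1 - ‖z‖ := by linarith
  have hp2 : 0 < 1 + ‖z‖ := by linarith [norm_nonneg z]
  simp only [e, mul_zero, add_zero, one_pow, div_one, zero_add, norm_mul, norm_pow,
    Complex.norm_real, Real.norm_of_nonneg hp.le, RCLike.norm_conj] at hfin
  have hfac : (0 : ℝ) < (m + 1).factorial := by exact_mod_cast Nat.factorial_pos _
  rw [Nat.add_sub_cancel, div_le_div_iff₀ hfac (by positivity)]
  have h3 : (1 - ‖z‖ ^ 2) ^ (m + 1) = (1 + ‖z‖) ^ m * ((1 - ‖z‖) ^ m * (1 - ‖z‖ ^ 2)) := by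
    rw [pow_succ, ← mul_assoc, ← mul_pow]; congr 2; ring
  rw [h3] at hfin
  refine le_of_mul_le_mul_left ?_ (pow_pos hp2 m)
  linarith
end

section
/- For k ∈ [0,1) and a ∈ [0,1), if |a_n| ≤ 1 - a^2 for n ≥ 1 and Σ_{n=2}^∞ n|b_n|ρ^{n-1} ≤ k Σ_{n=1}^∞ n|a_n|ρ^n for all ρ ≤ 1/3, then Σ_{n=2}^∞ |b_n|ρ^n ≤ k(1-a^2)(ρ/(1-ρ) + log(1-ρ)) for ρ ≤ 1/3. -/
lemma aux_mono (C ρ : ℝ) (B : ℕ → ℝ) (N : ℕ) (h0 : 0 ≤ ρ) (h1 : ρ ≤ 1 / 3)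
    (h : ∀ x, 0 < x → x < ρ →
      ∑ n ∈ Finset.range N, ((n + 2 : ℝ)) * B (n + 2) * x ^ (n + 1) ≤ C * (x / (1 - x) ^ 2)) :
    ∑ n ∈ Finset.range N, B (n + 2) * ρ ^ (n + 2)
      ≤ C * (ρ / (1 - ρ) + Real.log (1 - ρ)) := by
  have hd : ∀ x : ℝ, x ≤ ρ → HasDerivAt (fun x : ℝ => C * (x / (1 - x) + Real.log (1 - x))
      - ∑ n ∈ Finset.range N, B (n + 2) * x ^ (n + 2))
      (C * (x / (1 - x) ^ 2)
        - ∑ n ∈ Finset.range N, ((n + 2 : ℝ)) * B (n + 2) * x ^ (n + 1)) x := by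
    intro x hx
    have hne : (1 - x) ≠ 0 := by linarith
    have e1 : HasDerivAt (fun x : ℝ => 1 - x) (-1) x := by
      simpa using (hasDerivAt_id x).const_sub 1
    have e2 := (((hasDerivAt_id x).div e1 hne).add (e1.log hne)).const_mul C
    have e3 : HasDerivAt (fun x : ℝ => ∑ n ∈ Finset.range N, B (n + 2) * x ^ (n + 2))
        (∑ n ∈ Finset.range N, ((n + 2 : ℝ)) * B (n + 2) * x ^ (n + 1)) x := by
      apply HasDerivAt.fun_sum
      intro n _
      have := (hasDerivAt_pow (n + 2) x).const_mul (B (n + 2))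
      refine this.congr_deriv ?_
      have e : n + 2 - 1 = n + 1 := rfl
      rw [e]
      push_cast
      ring
    refine HasDerivAt.sub ?_ e3
    refine e2.congr_deriv ?_
    simp only [id]
    field_simp
    ring
  have hm : MonotoneOn (fun x : ℝ => C * (x / (1 - x) + Real.log (1 - x))
      - ∑ n ∈ Finset.range N, B (n + 2) * x ^ (n + 2)) (Set.Icc 0 ρ) := by
    apply monotoneOn_of_deriv_nonneg (convex_Icc 0 ρ)
    · exact fun x hx => (hd x hx.2).continuousAt.continuousWithinAt
    · intro x hx
      rw [interior_Icc] at hx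
      exact (hd x hx.2.le).differentiableAt.differentiableWithinAt
    · intro x hx
      rw [interior_Icc] at hx
      rw [(hd x hx.2.le).deriv]
      linarith [h x hx.1 hx.2]
  have := hm (Set.left_mem_Icc.2 h0) (Set.right_mem_Icc.2 h0) h0
  simp at this
  linarith

/-- Integrated coefficient inequality: from
`Σ_{n≥2} n|bₙ|ρ^{n-1} ≤ k Σ_{n≥1} n|aₙ|ρⁿ` with `|aₙ| ≤ 1-a²`, one gets
`Σ_{n≥2} |bₙ|ρⁿ ≤ k(1-a²)(ρ/(1-ρ) + log(1-ρ))` for `ρ ≤ 1/3`. -/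
theorem integrated_bound (a k : ℝ) (A B : ℕ → ℝ)
    (ha0 : 0 ≤ a) (ha1 : a < 1) (hk0 : 0 ≤ k) (hk1 : k < 1)
    (hAnn : ∀ n, 0 ≤ A n) (hBnn : ∀ n, 0 ≤ B n)
    (hA : ∀ n : ℕ, 1 ≤ n → A n ≤ 1 - a ^ 2)
    (hB : ∀ ρ : ℝ, 0 ≤ ρ → ρ ≤ 1 / 3 →
      ∑' n : ℕ, ((n + 2 : ℝ)) * B (n + 2) * ρ ^ (n + 1)
        ≤ k * ∑' n : ℕ, ((n + 1 : ℝ)) * A (n + 1) * ρ ^ (n + 1)) :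
    ∀ ρ : ℝ, 0 ≤ ρ → ρ ≤ 1 / 3 →
      ∑' n : ℕ, B (n + 2) * ρ ^ (n + 2)
        ≤ k * (1 - a ^ 2) * (ρ / (1 - ρ) + Real.log (1 - ρ)) := by
  intro ρ h0 h1
  have hC : 0 ≤ 1 - a ^ 2 := (hAnn 1).trans (hA 1 le_rfl)
  by_cases hs : Summable (fun n : ℕ => B (n + 2) * ρ ^ (n + 2))
  · refine Real.tsum_le_of_sum_range_le (fun n => mul_nonneg (hBnn _) (by positivity)) ?_
    intro N
    refine aux_mono _ ρ B N h0 h1 ?_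
    intro x hx hxr
    have hρ : 0 < ρ := hx.trans hxr
    have hx1 : ‖x‖ < 1 := by rw [Real.norm_of_nonneg hx.le]; linarith
    have hsx : Summable (fun n : ℕ => ((n + 2 : ℝ)) * B (n + 2) * x ^ (n + 1)) := by
      have hq : ‖x / ρ‖ < 1 := by
        rw [Real.norm_of_nonneg (by positivity)]
        exact (div_lt_one hρ).2 hxr
      have g := summable_pow_mul_geometric_of_norm_lt_one 1 hq
      have g2 := ((summable_nat_add_iff 2).2 g).mul_left
        ((∑' n : ℕ, B (n + 2) * ρ ^ (n + 2)) * x⁻¹)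
      refine Summable.of_nonneg_of_le
        (fun n => mul_nonneg (mul_nonneg (by positivity) (hBnn _)) (by positivity)) ?_ g2
      intro n
      have hle : B (n + 2) * ρ ^ (n + 2) ≤ ∑' n : ℕ, B (n + 2) * ρ ^ (n + 2) :=
        hs.le_tsum n (fun m _ => mul_nonneg (hBnn _) (by positivity))
      have e : ((n + 2 : ℝ)) * B (n + 2) * x ^ (n + 1)
          = (B (n + 2) * ρ ^ (n + 2)) * (x⁻¹ * ((n + 2 : ℝ) * (x / ρ) ^ (n + 2))) := by
        rw [div_pow]
        field_simp
        ring
      rw [e]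
      refine (mul_le_mul_of_nonneg_right hle (by positivity)).trans (le_of_eq ?_)
      push_cast
      ring
    have hg : HasSum (fun n : ℕ => ((n + 1 : ℝ)) * x ^ (n + 1)) (x / (1 - x) ^ 2) := by
      have := (hasSum_nat_add_iff' (f := fun n : ℕ => (n : ℝ) * x ^ n) 1).2
        (hasSum_coe_mul_geometric_of_norm_lt_one hx1)
      simp only [Finset.range_one, Finset.sum_singleton, Nat.cast_zero, zero_mul, sub_zero,
        Nat.cast_add, Nat.cast_one] at this
      exact this
    have hg2 := hg.mul_left (1 - a ^ 2)
    have hle : ∀ n : ℕ, ((n + 1 : ℝ)) * A (n + 1) * x ^ (n + 1)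
        ≤ (1 - a ^ 2) * (((n + 1 : ℝ)) * x ^ (n + 1)) := by
      intro n
      have := mul_le_mul_of_nonneg_right (hA (n + 1) (by omega))
        (show 0 ≤ ((n + 1 : ℝ)) * x ^ (n + 1) by positivity)
      linarith
    have hsA : Summable (fun n : ℕ => ((n + 1 : ℝ)) * A (n + 1) * x ^ (n + 1)) :=
      Summable.of_nonneg_of_le
        (fun n => mul_nonneg (mul_nonneg (by positivity) (hAnn _)) (by positivity))
        hle hg2.summable
    have h3 := hsA.tsum_le_tsum hle hg2.summable
    rw [hg2.tsum_eq] at h3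
    calc _ ≤ ∑' n : ℕ, ((n + 2 : ℝ)) * B (n + 2) * x ^ (n + 1) :=
          hsx.sum_le_tsum _
            (fun n _ => mul_nonneg (mul_nonneg (by positivity) (hBnn _)) (by positivity))
      _ ≤ _ := hB x hx.le (by linarith)
      _ ≤ k * ((1 - a ^ 2) * (x / (1 - x) ^ 2)) := mul_le_mul_of_nonneg_left h3 hk0
      _ = _ := by ring
  · rw [tsum_eq_zero_of_not_summable hs]
    have := aux_mono (k * (1 - a ^ 2)) ρ B 0 h0 h1 (by
      intro x hx _
      simp only [Finset.range_zero, Finset.sum_empty]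
      positivity)
    simpa using this
end
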